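/- Let S be an integral domain that is finitely generated as a ℤ-algebra whose fraction field has positive transcendence degree over ℚ. Then for all but finitely many primes p, the set of ring homomorphisms Hom_ring(S, 𝔽̄_p) into an algebraic closure of 𝔽_p is infinite. -/

import Mathlib

lemma aux_null (F T : Type*) [Field F] [IsAlgClosed F] [CommRing T] [Nontrivial T] [Algebra F T]
    [Algebra.FiniteType F T] : Nonempty (T →ₐ[F] F) := by
  obtain ⟨m, hm⟩ := Ideal.exists_maximal T
  let := Ideal.Quotient.field m
  have : Algebra.FiniteType F (T ⧸ m) :=
    Algebra.FiniteType.trans (S := T) inferInstance inferInstance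
  have := finite_of_finite_type_of_isJacobsonRing F (T ⧸ m)
  let e : (T ⧸ m) →ₐ[F] F := IsAlgClosed.lift
  exact ⟨e.comp (Ideal.Quotient.mkₐ F m)⟩

open Polynomial TensorProduct in
lemma aux_ext {A S F : Type*} [CommRing A] [CommRing S] [Field F] [IsAlgClosed F]
    [Algebra A S] [Algebra.FiniteType A S] (φ : A →+* F)
    (q : Ideal S) [q.IsPrime] (hq : q.comap (algebraMap A S) = RingHom.ker φ) :
    ∃ ψ : S →+* F, ψ.comp (algebraMap A S) = φ := by
  let P : Ideal A := RingHom.ker φ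
  let i1 : Algebra (A ⧸ P) (S ⧸ q) := (Ideal.quotientMap q (algebraMap A S) hq.ge).toAlgebra
  let i2 : Algebra (A ⧸ P) F := (RingHom.kerLift φ).toAlgebra
  have h1 : Function.Injective (algebraMap (A ⧸ P) (S ⧸ q)) :=
    Ideal.quotientMap_injective' hq.le
  have h2 : Function.Injective (algebraMap (A ⧸ P) F) := RingHom.kerLift_injective φ
  have := Algebra.TensorProduct.nontrivial_of_algebraMap_injective_of_isDomain (A ⧸ P) F (S ⧸ q) h2 h1
  have : IsScalarTower A (A ⧸ P) (S ⧸ q) := IsScalarTower.of_algebraMap_eq (fun _ => rfl)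
  have : Algebra.FiniteType A (S ⧸ q) :=
    Algebra.FiniteType.trans (S := S) ‹_› inferInstance
  have : Algebra.FiniteType (A ⧸ P) (S ⧸ q) := Algebra.FiniteType.of_restrictScalars_finiteType A _ _
  obtain ⟨g⟩ := aux_null F (F ⊗[A ⧸ P] (S ⧸ q))
  let j : (S ⧸ q) →ₐ[A ⧸ P] F := (g.restrictScalars (A ⧸ P)).comp Algebra.TensorProduct.includeRight
  refine ⟨(j : (S ⧸ q) →+* F).comp (Ideal.Quotient.mk q), ?_⟩
  ext a
  exact j.commutes (Ideal.Quotient.mk P a)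

open PrimeSpectrum in
lemma aux_open {A S : Type*} [CommRing A] [IsDomain A] [IsNoetherianRing A] [CommRing S] [IsDomain S]
    [Algebra A S] [Algebra.FiniteType A S] (hinj : Function.Injective (algebraMap A S)) :
    ∃ f : A, f ≠ 0 ∧ ∀ P : Ideal A, P.IsPrime → f ∉ P →
      ∃ q : Ideal S, q.IsPrime ∧ q.comap (algebraMap A S) = P := by
  have hfp : (algebraMap A S).FinitePresentation :=
    RingHom.FinitePresentation.of_finiteType.mp ((RingHom.finiteType_algebraMap).mpr ‹_›)
  obtain ⟨C, hC⟩ := exists_constructibleSetData_iff.mpr (isConstructible_range_comap hfp)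
  have h0 : (⊥ : PrimeSpectrum A) ∈ C.toSet := by
    rw [hC]
    refine ⟨⊥, PrimeSpectrum.ext ?_⟩
    exact (RingHom.injective_iff_ker_eq_bot _).mp hinj
  simp only [ConstructibleSetData.toSet, Set.mem_iUnion] at h0
  obtain ⟨D, hD, hg, hf⟩ := h0
  refine ⟨D.f, fun h => hf (by simp [h]), fun P hP hfP => ?_⟩
  have : (⟨P, hP⟩ : PrimeSpectrum A) ∈ C.toSet := by
    simp only [ConstructibleSetData.toSet, Set.mem_iUnion]
    refine ⟨D, hD, ?_, ?_⟩
    · exact fun x hx => by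
        have : x = 0 := hg hx
        simp [this]
    · simpa using hfP
  rw [hC] at this
  obtain ⟨q, hq⟩ := this
  exact ⟨q.asIdeal, q.2, congrArg PrimeSpectrum.asIdeal hq⟩

lemma aux_trans' (S K : Type*) [CommRing S] [IsDomain S] [Field K] [Algebra S K]
    [IsFractionRing S K] [Algebra ℚ K] [Algebra.Transcendental ℚ K] :
    ∃ t : S, Transcendental ℤ t := by
  by_contra! h
  have h1 : Algebra.IsAlgebraic ℤ S := ⟨fun x => by simpa [Transcendental] using h x⟩
  have h0 : Algebra.IsAlgebraic S K := IsLocalization.isAlgebraic K (nonZeroDivisors S)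
  have h2 : Algebra.IsAlgebraic ℤ K :=
    Algebra.IsAlgebraic.trans ℤ S K
  have h3 : Algebra.IsAlgebraic ℚ K :=
    (IsFractionRing.comap_isAlgebraic_iff (A := ℤ)).mp h2
  exact Algebra.transcendental_iff_not_isAlgebraic.mp ‹_› h3

lemma aux_trans (S : Type*) [CommRing S] [IsDomain S] [CharZero S]
    [Algebra.Transcendental ℚ (FractionRing S)] : ∃ t : S, Transcendental ℤ t :=
  aux_trans' S (FractionRing S)

theorem stmt10 (S : Type*) [CommRing S] [IsDomain S] [CharZero S]
    [Algebra.FiniteType ℤ S] [Algebra.Transcendental ℚ (FractionRing S)] :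
    ∃ B : Finset ℕ, ∀ p : ℕ, p.Prime → p ∉ B →
      ∀ (F : Type) [Field F] [CharP F p] [IsAlgClosed F], Infinite (S →+* F) := by
  obtain ⟨t, ht⟩ := aux_trans S
  let : Algebra (Polynomial ℤ) S := (Polynomial.aeval (R := ℤ) t).toRingHom.toAlgebra
  have hinj : Function.Injective (algebraMap (Polynomial ℤ) S) := transcendental_iff_injective.mp ht
  have : IsScalarTower ℤ (Polynomial ℤ) S := IsScalarTower.of_algebraMap_eq (fun _ => by simp)
  have : Algebra.FiniteType (Polynomial ℤ) S :=
    Algebra.FiniteType.of_restrictScalars_finiteType ℤ _ _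
  obtain ⟨f, hf, H⟩ := aux_open hinj
  refine ⟨f.leadingCoeff.natAbs.primeFactors, fun p hp hpB F _ _ _ => ?_⟩
  have hfp : f.map (Int.castRingHom F) ≠ 0 := by
    intro h
    apply hpB
    have h1 : ((f.leadingCoeff : ℤ) : F) = 0 := by
      have := congrArg (fun g => Polynomial.coeff g f.natDegree) h
      simpa using this
    rw [CharP.intCast_eq_zero_iff F p, Int.natCast_dvd] at h1
    exact Nat.mem_primeFactors.mpr ⟨hp, h1, by simpa using hf⟩
  have : Infinite F := IsAlgClosed.instInfinite
  have hU : {a : F | ¬ (f.map (Int.castRingHom F)).IsRoot a}.Infinite :=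
    (Polynomial.finite_setOfPred_isRoot hfp).infinite_compl
  have key : ∀ a : {a : F | ¬ (f.map (Int.castRingHom F)).IsRoot a}, ∃ ψ : S →+* F, ψ t = a := by
    rintro ⟨a, ha⟩
    let φ : Polynomial ℤ →+* F := Polynomial.eval₂RingHom (Int.castRingHom F) a
    obtain ⟨q, hq, hq'⟩ := H (RingHom.ker φ) (RingHom.ker_isPrime φ) (by
      simpa [φ, RingHom.mem_ker, Polynomial.eval_map] using ha)
    obtain ⟨ψ, hψ⟩ := aux_ext φ q hq'
    refine ⟨ψ, ?_⟩
    have h1 : algebraMap (Polynomial ℤ) S Polynomial.X = t := Polynomial.aeval_X t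
    have := congrArg (fun g : Polynomial ℤ →+* F => g Polynomial.X) hψ
    simpa [h1, φ] using this
  choose ψ hψ using key
  have := hU.to_subtype
  refine Infinite.of_injective ψ fun a b hab => ?_
  exact Subtype.ext (by rw [← hψ a, ← hψ b, hab])
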